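/- Let F be a field, V a finite-dimensional F-vector space, A : V → V a linear endomorphism, and m a positive integer. Let C denote the linear automorphism of the m-th tensor power V^{⊗m} cyclically permuting the tensor factors (sending v₁ ⊗ ⋯ ⊗ v_m to the tensor with factors rearranged by the m-cycle), and let A^{⊗m} : V^{⊗m} → V^{⊗m} be the m-fold tensor power of A. Then tr(C ∘ A^{⊗m}) = tr(A^m). -/

import Mathlib

open scoped TensorProduct PiTensorProduct

theorem Fin.sum_pi_succ {α R : Type*} [Fintype α] [AddCommMonoid R] {n : ℕ}
    (g : (Fin (n + 1) → α) → R) :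
    ∑ p, g p = ∑ i, ∑ q : Fin n → α, g (Fin.cons i q) := by
  rw [← (Fin.consEquiv fun _ : Fin (n + 1) => α).sum_comp, Fintype.sum_prod_type]
  rfl

namespace Matrix

variable {ι R : Type*} [Fintype ι] [DecidableEq ι] [CommSemiring R]

/-- The entries of a matrix power applied to a vector, as a sum over walks. -/
theorem pow_mulVec_eq_sum_walks (N : Matrix ι ι R) (n : ℕ) (f : ι → R) (i : ι) :
    ((N ^ n) *ᵥ f) i = ∑ q : Fin n → ι,
      (∏ k : Fin n, N ((Fin.cons i q : Fin (n + 1) → ι) k.castSucc) (q k)) *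
        f ((Fin.cons i q : Fin (n + 1) → ι) (Fin.last n)) := by
  induction n generalizing i with
  | zero => simp
  | succ n ih =>
    rw [pow_succ', ← mulVec_mulVec, Fin.sum_pi_succ]
    change ∑ j, N i j * ((N ^ n) *ᵥ f) j = _
    refine Finset.sum_congr rfl fun j _ => ?_
    rw [ih, Finset.mul_sum]
    refine Finset.sum_congr rfl fun q _ => ?_
    rw [Fin.prod_univ_succ, ← Fin.succ_last]
    simp only [Fin.castSucc_zero, Fin.cons_zero, Fin.cons_succ, ← Fin.succ_castSucc]
    ring

/-- The trace of a positive matrix power, as a sum over closed walks. -/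
theorem trace_pow_eq_sum_finRotate (N : Matrix ι ι R) {m : ℕ} (hm : 0 < m) :
    (N ^ m).trace = ∑ p : Fin m → ι, ∏ k, N (p k) (p (finRotate m k)) := by
  obtain ⟨n, rfl⟩ := Nat.exists_eq_succ_of_ne_zero hm.ne'
  rw [Nat.succ_eq_add_one, Fin.sum_pi_succ]
  refine Finset.sum_congr rfl fun i _ => ?_
  rw [pow_succ]
  change ((N ^ n) *ᵥ fun j => N j i) i = _
  rw [pow_mulVec_eq_sum_walks]
  refine Finset.sum_congr rfl fun q _ => ?_
  rw [Fin.prod_univ_castSucc, finRotate_last]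
  simp only [finRotate_apply, Fin.coeSucc_eq_succ, Fin.cons_succ, Fin.cons_zero]

end Matrix

/-- The trace of a permutation of tensor factors composed with a tensor power, in a basis. -/
theorem PiTensorProduct.trace_reindex_comp_map {ι κ R M : Type*} [Fintype ι] [Fintype κ]
    [DecidableEq ι] [DecidableEq κ] [CommRing R] [AddCommGroup M] [Module R M]
    (b : Module.Basis κ R M) (σ : Equiv.Perm ι) (A : M →ₗ[R] M) :
    LinearMap.trace R (⨂[R] _ : ι, M)
        ((PiTensorProduct.reindex R (fun _ : ι => M) σ).toLinearMap ∘ₗ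
          PiTensorProduct.map fun _ : ι => A) =
      ∑ p : ι → κ, ∏ i, LinearMap.toMatrix b b A (p (σ i)) (p i) := by
  rw [LinearMap.trace_eq_matrix_trace R (Basis.piTensorProduct fun _ : ι => b)]
  refine Finset.sum_congr rfl fun p _ => ?_
  rw [Matrix.diag_apply, LinearMap.toMatrix_apply, Basis.piTensorProduct_apply,
    LinearMap.comp_apply, PiTensorProduct.map_tprod, LinearEquiv.coe_coe,
    PiTensorProduct.reindex_tprod, Basis.piTensorProduct_repr_tprod_apply, ← Equiv.prod_comp σ]
  simp [LinearMap.toMatrix_apply]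

/-- Trace of a cyclically twisted tensor power: if `C` cyclically permutes the factors of
the `m`-th tensor power `V^{⊗m}` of a finite-dimensional vector space `V` and `A^{⊗m}` is
the `m`-th tensor power of an endomorphism `A` of `V`, then `tr(C ∘ A^{⊗m}) = tr(A^m)`
(the `m`-th Adams operation applied to the character of `A`). -/
theorem trace_cyclic_comp_tensorPower_map {F V : Type*} [Field F] [AddCommGroup V]
    [Module F V] [FiniteDimensional F V] (m : ℕ) (hm : 0 < m) (A : V →ₗ[F] V) :
    LinearMap.trace F (⨂[F] _ : Fin m, V)
        ((PiTensorProduct.reindex F (fun _ : Fin m => V) (finRotate m)).toLinearMap ∘ₗ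
          PiTensorProduct.map fun _ : Fin m => A) =
      LinearMap.trace F V (A ^ m) := by
  let b := Module.finBasis F V
  rw [PiTensorProduct.trace_reindex_comp_map b, LinearMap.trace_eq_matrix_trace F b,
    ← LinearMap.toMatrix_pow, ← Matrix.trace_transpose, Matrix.transpose_pow,
    Matrix.trace_pow_eq_sum_finRotate _ hm]
  rfl
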